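/- Let Q = K = 2 and assume Assumption (A). Then F is a proper mapping (i.e., ‖F(x)‖ → ∞ as ‖x‖ → ∞) if and only if for each ordered pair (k,l) ∈ {(1,2),(2,1)} there exists an index q = q(k,l) ∈ {1,2} such that s^{[q]}_m = 0 for every m ∈ 𝓜(k,l), where 𝓜(k,l) := {m ∈ {1,…,M} : b_{km}/b_{lm} = max_{1 ≤ m' ≤ M} b_{km'}/b_{lm'}}. -/

import Mathlib

open scoped BigOperators

/-- The map `F : ℝ² → ℝ²`, `F_q(x) = ln ∑_m s^{[q]}_m ζ_m(x)`,
viewed as a map on Euclidean space (so `‖·‖` is the Euclidean norm). -/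
noncomputable def FmapE {K M : ℕ} (S B : Matrix (Fin K) (Fin M) ℝ)
    (x : EuclideanSpace ℝ (Fin K)) : EuclideanSpace ℝ (Fin K) :=
  WithLp.toLp 2 (fun q => Real.log (∑ m, S q m * Real.exp (-(∑ k, B k m * x k))))

/-- A map `H : ℝ^n → ℝ^n` is proper if `‖H(x)‖ → ∞` as `‖x‖ → ∞`. -/
def ProperMap {K : ℕ} (H : EuclideanSpace ℝ (Fin K) → EuclideanSpace ℝ (Fin K)) : Prop :=
  Filter.Tendsto (fun x => ‖H x‖)
    (Filter.comap (fun x : EuclideanSpace ℝ (Fin K) => ‖x‖) Filter.atTop) Filter.atTop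

lemma aux_sum (M : ℕ) (B : Matrix (Fin 2) (Fin M) ℝ) (x : EuclideanSpace ℝ (Fin 2))
    (k l : Fin 2) (hkl : k ≠ l) (m : Fin M) :
    (∑ k, B k m * x k) = B k m * x k + B l m * x l := by
  fin_cases k <;> fin_cases l <;> simp [Fin.sum_univ_two] at hkl ⊢
  ring

lemma aux_upper (M : ℕ) (S : Matrix (Fin 2) (Fin M) ℝ) (hS : ∀ q m, 0 ≤ S q m)
    (y : Fin M → ℝ) (C : ℝ) (q : Fin 2) (m : Fin M) (hm : S q m ≠ 0)
    (h : Real.log (∑ m, S q m * Real.exp (-(y m))) ≤ C) :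
    Real.log (S q m) - C ≤ y m := by
  have hpos : 0 < S q m := lt_of_le_of_ne (hS q m) (Ne.symm hm)
  have h1 : S q m * Real.exp (-(y m)) ≤ ∑ m, S q m * Real.exp (-(y m)) :=
    Finset.single_le_sum (f := fun m => S q m * Real.exp (-(y m)))
      (fun i _ => mul_nonneg (hS q i) (Real.exp_pos _).le) (Finset.mem_univ m)
  have h2 := Real.log_le_log (mul_pos hpos (Real.exp_pos _)) h1
  rw [Real.log_mul hpos.ne' (Real.exp_pos _).ne', Real.log_exp] at h2
  linarith

lemma aux_pos (M : ℕ) (S : Matrix (Fin 2) (Fin M) ℝ) (hS : ∀ q m, 0 ≤ S q m)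
    (hSrow : ∀ q, ∑ m, S q m = 1) (q : Fin 2) : ∃ m, S q m ≠ 0 := by
  by_contra! h
  have := hSrow q
  simp [h] at this

lemma aux_lower (M : ℕ) (S : Matrix (Fin 2) (Fin M) ℝ) (hS : ∀ q m, 0 ≤ S q m)
    (hSrow : ∀ q, ∑ m, S q m = 1)
    (y : Fin M → ℝ) (C : ℝ) (q : Fin 2)
    (h : -C ≤ Real.log (∑ m, S q m * Real.exp (-(y m)))) :
    ∃ m, S q m ≠ 0 ∧ y m ≤ C := by
  by_contra! hc
  obtain ⟨m0, hm0⟩ := aux_pos M S hS hSrow q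
  have hpos : 0 < S q m0 := lt_of_le_of_ne (hS q m0) (Ne.symm hm0)
  have h1 : 0 < ∑ m, S q m * Real.exp (-(y m)) :=
    Finset.sum_pos' (fun i _ => mul_nonneg (hS q i) (Real.exp_pos _).le)
      ⟨m0, Finset.mem_univ _, mul_pos hpos (Real.exp_pos _)⟩
  have h2 : ∑ m, S q m * Real.exp (-(y m)) < ∑ m, S q m * Real.exp (-C) := by
    apply Finset.sum_lt_sum
    · intro i _
      by_cases hi : S q i = 0
      · simp [hi]
      · exact mul_le_mul_of_nonneg_left (Real.exp_le_exp.2 (by linarith [hc i hi])) (hS q i)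
    · exact ⟨m0, Finset.mem_univ _,
        mul_lt_mul_of_pos_left (Real.exp_lt_exp.2 (by linarith [hc m0 hm0])) hpos⟩
  rw [← Finset.sum_mul, hSrow, one_mul] at h2
  have h3 := Real.log_lt_log h1 h2
  rw [Real.log_exp] at h3
  linarith

lemma aux_fin {M : ℕ} (D : Fin M → ℝ) : ∃ U, ∀ m, D m ≤ U := by
  obtain ⟨U, hU⟩ := (Set.finite_range D).bddAbove
  exact ⟨U, fun m => hU ⟨m, rfl⟩⟩

lemma aux_coord (M : ℕ) (hM : 2 ≤ M)
    (S B : Matrix (Fin 2) (Fin M) ℝ)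
    (hS : ∀ q m, 0 ≤ S q m) (hB : ∀ k m, 0 < B k m)
    (hScol : ∀ m, ∃ q, S q m ≠ 0)
    (hSrow : ∀ q, ∑ m, S q m = 1) (k l : Fin 2) (hkl : k ≠ l)
    (hex : ∃ q : Fin 2, ∀ m : Fin M,
        (∀ m', B k m' / B l m' ≤ B k m / B l m) → S q m = 0) (C : ℝ) :
    ∃ L, ∀ x, (∀ q, |FmapE S B x q| ≤ C) → -x k ≤ L := by
  obtain ⟨q, hq⟩ := hex
  haveI : Nonempty (Fin M) := ⟨⟨0, by omega⟩⟩
  obtain ⟨ms, hms⟩ := Finite.exists_max (fun m => B k m / B l m)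
  obtain ⟨q1, hq1⟩ := hScol ms
  obtain ⟨U, hU⟩ := aux_fin (fun m =>
    (C / B l m - (Real.log (S q1 ms) - C) / B l ms) / (B k ms / B l ms - B k m / B l m))
  refine ⟨U, fun x hx => ?_⟩
  have h1 := aux_upper M S hS (fun m => ∑ k, B k m * x k) C q1 ms hq1 (abs_le.1 (hx q1)).2
  obtain ⟨m, hm, h2⟩ := aux_lower M S hS hSrow (fun m => ∑ k, B k m * x k) C q (abs_le.1 (hx q)).1
  refine le_trans ?_ (hU m)
  have hlt : B k m / B l m < B k ms / B l ms := by
    refine lt_of_le_of_ne (hms m) fun he => hm (hq m fun m' => ?_)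
    rw [he]; exact hms m'
  simp only [aux_sum M B x k l hkl] at h1 h2
  rw [le_div_iff₀ (by linarith)]
  have h3 : (Real.log (S q1 ms) - C) / B l ms ≤ B k ms / B l ms * x k + x l := by
    rw [div_le_iff₀ (hB l ms)]
    have := (hB l ms).ne'
    have e : (B k ms / B l ms * x k + x l) * B l ms = B k ms * x k + B l ms * x l := by
      field_simp
    rw [e]; exact h1
  have h4 : B k m / B l m * x k + x l ≤ C / B l m := by
    rw [le_div_iff₀ (hB l m)]
    have := (hB l m).ne'
    have e : (B k m / B l m * x k + x l) * B l m = B k m * x k + B l m * x l := by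
      field_simp
    rw [e]; exact h2
  nlinarith

lemma aux_norm (z : EuclideanSpace ℝ (Fin 2)) : ‖z‖ ≤ |z 0| + |z 1| := by
  rw [EuclideanSpace.norm_eq, Fin.sum_univ_two, Real.sqrt_le_left (by positivity)]
  simp only [Real.norm_eq_abs]
  nlinarith [abs_nonneg (z 0), abs_nonneg (z 1)]

lemma aux_up (M : ℕ) (S B : Matrix (Fin 2) (Fin M) ℝ)
    (hS : ∀ q m, 0 ≤ S q m) (hB : ∀ k m, 0 < B k m)
    (hSrow : ∀ q, ∑ m, S q m = 1) (k l : Fin 2) (hkl : k ≠ l) (C L : ℝ) :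
    ∃ U, ∀ x, (∀ q, |FmapE S B x q| ≤ C) → -x l ≤ L → x k ≤ U := by
  obtain ⟨U, hU⟩ := aux_fin (fun m => (C + B l m * L) / B k m)
  refine ⟨U, fun x hx hl => ?_⟩
  obtain ⟨m, hm, h2⟩ := aux_lower M S hS hSrow (fun m => ∑ k, B k m * x k) C 0 (abs_le.1 (hx 0)).1
  refine le_trans ?_ (hU m)
  simp only [aux_sum M B x k l hkl] at h2
  rw [le_div_iff₀ (hB k m)]
  nlinarith [mul_le_mul_of_nonneg_left hl (hB l m).le]

/-- In DECT (`Q = K = 2`), under Assumption (A), `F` is a proper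
mapping if and only if for every ordered pair `(k,l)` with `k ≠ l` there is a spectrum
index `q` with `s^{[q]}_m = 0` for every `m ∈ 𝓜(k,l)`, where `𝓜(k,l)` is the set of
maximizers of `m ↦ b_{km}/b_{lm}`. -/
theorem Fmap_proper_iff_DECT (M : ℕ) (hM : 2 ≤ M)
    (S B : Matrix (Fin 2) (Fin M) ℝ)
    (hS : ∀ q m, 0 ≤ S q m) (hB : ∀ k m, 0 < B k m)
    (hScol : ∀ m, ∃ q, S q m ≠ 0)
    (hSrow : ∀ q, ∑ m, S q m = 1) :
    ProperMap (FmapE S B) ↔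
      ∀ k l : Fin 2, k ≠ l → ∃ q : Fin 2, ∀ m : Fin M,
        (∀ m', B k m' / B l m' ≤ B k m / B l m) → S q m = 0 := by
  constructor
  · intro hp k l hkl
    by_contra! hc
    choose mm hmax hne using hc
    have hpos : ∀ q, 0 < S q (mm q) := fun q => lt_of_le_of_ne (hS _ _) (Ne.symm (hne q))
    set r := B k (mm 0) / B l (mm 0) with hr
    have hrle : ∀ m, B k m / B l m ≤ r := fun m => hmax 0 m
    have hreq : ∀ q, B k (mm q) / B l (mm q) = r := fun q =>
      le_antisymm (hrle _) (hmax q _)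
    have hev := (Filter.tendsto_atTop.1 hp)
      (|Real.log (S 0 (mm 0))| + |Real.log (S 1 (mm 1))| + 1)
    rw [Filter.eventually_comap, Filter.eventually_atTop] at hev
    obtain ⟨R, hR⟩ := hev
    let x : EuclideanSpace ℝ (Fin 2) :=
      WithLp.toLp 2 (fun i => if i = k then -|R| else r * |R|)
    have hxk : x k = -|R| := by simp [x]
    have hxl : x l = r * |R| := by simp [x, hkl.symm]
    have hnorm : R ≤ ‖x‖ := by
      have := PiLp.norm_apply_le x k
      rw [hxk, norm_neg, Real.norm_eq_abs, abs_abs] at this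
      exact (le_abs_self R).trans this
    have hF := hR _ hnorm x rfl
    have hy : ∀ m, (∑ k, B k m * x k) = B l m * |R| * (r - B k m / B l m) := by
      intro m
      rw [aux_sum M B x k l hkl, hxk, hxl]
      have := (hB l m).ne'
      field_simp
      ring
    have hb : ∀ q, |FmapE S B x q| ≤ |Real.log (S q (mm q))| := by
      intro q
      have h1 : S q (mm q) ≤ ∑ m, S q m * Real.exp (-(∑ k, B k m * x k)) := by
        have := Finset.single_le_sum
          (f := fun m => S q m * Real.exp (-(∑ k, B k m * x k)))
          (fun i _ => mul_nonneg (hS q i) (Real.exp_pos _).le) (Finset.mem_univ (mm q))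
        simp only [hy (mm q), hreq q, sub_self, mul_zero, neg_zero, Real.exp_zero, mul_one] at this
        exact this
      have h2 : ∑ m, S q m * Real.exp (-(∑ k, B k m * x k)) ≤ 1 := by
        rw [← hSrow q]
        refine Finset.sum_le_sum fun m _ => ?_
        refine mul_le_of_le_one_right (hS q m) (Real.exp_le_one_iff.2 ?_)
        rw [hy m, neg_nonpos]
        exact mul_nonneg (mul_nonneg (hB l m).le (abs_nonneg R)) (sub_nonneg.2 (hrle m))
      have h3 := Real.log_le_log (hpos q) h1
      have h4 := Real.log_nonpos ((hpos q).le.trans h1) h2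
      change |Real.log (∑ m, S q m * Real.exp (-(∑ k, B k m * x k)))| ≤ _
      rw [abs_of_nonpos h4, abs_of_nonpos (h3.trans h4)]
      linarith
    have := aux_norm (FmapE S B x)
    linarith [hb 0, hb 1]
  · intro h
    refine Filter.tendsto_atTop.2 fun C => ?_
    rw [Filter.eventually_comap, Filter.eventually_atTop]
    obtain ⟨L0, hL0⟩ := aux_coord M hM S B hS hB hScol hSrow 0 1 (by decide) (h 0 1 (by decide)) C
    obtain ⟨L1, hL1⟩ := aux_coord M hM S B hS hB hScol hSrow 1 0 (by decide) (h 1 0 (by decide)) C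
    obtain ⟨U0, hU0⟩ := aux_up M S B hS hB hSrow 0 1 (by decide) C L1
    obtain ⟨U1, hU1⟩ := aux_up M S B hS hB hSrow 1 0 (by decide) C L0
    refine ⟨max L0 U0 + max L1 U1 + 1, ?_⟩
    rintro _ hb x rfl
    by_contra! hlt
    have hx : ∀ q, |FmapE S B x q| ≤ C := fun q => by
      have := PiLp.norm_apply_le (FmapE S B x) q
      rw [Real.norm_eq_abs] at this
      exact this.trans hlt.le
    have a0 : |x 0| ≤ max L0 U0 := by
      rw [abs_le']
      exact ⟨(hU0 x hx (hL1 x hx)).trans (le_max_right _ _), (hL0 x hx).trans (le_max_left _ _)⟩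
    have a1 : |x 1| ≤ max L1 U1 := by
      rw [abs_le']
      exact ⟨(hU1 x hx (hL0 x hx)).trans (le_max_right _ _), (hL1 x hx).trans (le_max_left _ _)⟩
    linarith [aux_norm x]
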